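/- Suppose Assumptions 1 and 2 hold. Let 0 = t_0 < t_1 < t_2 < … be a sequence of sampling times which is either finite or satisfies t_k → ∞, let x̂ : [0,∞) → ℝⁿ be constant on each interval between consecutive sampling times, and let x : [0,∞) → ℝⁿ be locally absolutely continuous with ẋ_i(t) = f_i(x(t), g_i(x̂(t))) for almost every t ≥ 0 and every i ∈ {1,…,N}. If V_i(x_i(t)) ≥ χ_i(‖x̂_i(t) − x_i(t)‖) for all t ≥ 0 and all i, then the function t ↦ V(x(t)) is nonincreasing and x(t) → 0 as t → ∞. -/

import Mathlib

/-- A function `f : [0,∞) → [0,∞)` is of class K if it is continuous, strictly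
increasing and `f 0 = 0`. -/
def ClassK (f : ℝ → ℝ) : Prop :=
  ContinuousOn f (Set.Ici 0) ∧ StrictMonoOn f (Set.Ici 0) ∧
    (∀ r, 0 ≤ r → 0 ≤ f r) ∧ f 0 = 0

/-- A function is of class K∞ if it is of class K and unbounded. -/
def ClassKInf (f : ℝ → ℝ) : Prop :=
  ClassK f ∧ Filter.Tendsto f Filter.atTop Filter.atTop

/-- A continuous positive definite function `[0,∞) → [0,∞)`: vanishing exactly at 0. -/
def PosDefFun (f : ℝ → ℝ) : Prop :=
  ContinuousOn f (Set.Ici 0) ∧ (∀ r, 0 ≤ r → 0 ≤ f r) ∧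
    (∀ r, 0 ≤ r → (f r = 0 ↔ r = 0))

/-- A monotone aggregation function on `[0,∞)^m`: continuous, nonnegative, positive on
nonzero nonnegative vectors, strictly increasing componentwise, and unbounded. -/
def MAF {m : ℕ} (μ : (Fin m → ℝ) → ℝ) : Prop :=
  Continuous μ ∧
    (∀ v : Fin m → ℝ, (∀ k, 0 ≤ v k) → 0 ≤ μ v) ∧
    (∀ v : Fin m → ℝ, (∀ k, 0 ≤ v k) → v ≠ 0 → 0 < μ v) ∧
    (∀ v z : Fin m → ℝ, (∀ k, z k < v k) → μ z < μ v) ∧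
    (∀ M : ℝ, ∃ R : ℝ, ∀ v : Fin m → ℝ, (∀ k, 0 ≤ v k) → R ≤ ‖v‖ → M ≤ μ v)


open MeasureTheory Set Filter Topology
open scoped ENNReal NNReal

/-- Continuous induction on a compact interval: a property that holds at the left endpoint,
passes to left limits and propagates to the right holds at the right endpoint. -/
theorem Icc_continuous_induction {a b : ℝ} (hab : a ≤ b) {P : ℝ → Prop} (ha : P a)
    (hleft : ∀ t ∈ Ioc a b, (∀ s ∈ Ico a t, P s) → P t)
    (hright : ∀ t ∈ Ico a b, P t → ∀ᶠ s in 𝓝[>] t, P s) : P b := by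
  by_contra hb
  set S := {t | t ∈ Icc a b ∧ ¬ P t} with hS
  have hbS : b ∈ S := ⟨⟨hab, le_rfl⟩, hb⟩
  have hbdd : BddBelow S := ⟨a, fun t ht => ht.1.1⟩
  set c := sInf S with hc
  have hac : a ≤ c := le_csInf ⟨b, hbS⟩ fun t ht => ht.1.1
  have hcb : c ≤ b := csInf_le hbdd hbS
  have hlt : ∀ s ∈ Ico a c, P s := by
    intro s hs
    by_contra hPs
    exact absurd (csInf_le hbdd (show s ∈ S from ⟨⟨hs.1, hs.2.le.trans hcb⟩, hPs⟩))
      (not_le.2 hs.2)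
  have hPc : P c := by
    rcases hac.eq_or_lt with h | h
    · exact h ▸ ha
    · exact hleft c ⟨h, hcb⟩ hlt
  have hcb' : c < b := lt_of_le_of_ne hcb fun h => hb (h ▸ hPc)
  obtain ⟨d, hd, hPd⟩ := (mem_nhdsGT_iff_exists_Ioo_subset).1 (hright c ⟨hac, hcb'⟩ hPc)
  have : d ≤ c := by
    refine le_csInf ⟨b, hbS⟩ fun t ht => ?_
    by_contra! htd
    rcases (csInf_le hbdd ht).eq_or_lt with h | h
    · exact ht.2 (h ▸ hPc)
    · exact ht.2 (hPd ⟨h, htd⟩)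
  exact absurd hd (not_lt.2 this)

/-- If the right increments of a continuous function are locally controlled, at every point, by a
multiple of a finite measure and are nonpositive at almost every point for this measure, then the
function does not increase. -/
theorem le_of_ae_eventually_le {a b : ℝ} (hab : a ≤ b) (ν : Measure ℝ) [IsFiniteMeasure ν]
    {u : ℝ → ℝ} (hu : ContinuousOn u (Icc a b))
    (hloc : ∀ s ∈ Ico a b, ∃ C : ℝ≥0, ∀ᶠ s' in 𝓝[>] s,
      ENNReal.ofReal (u s' - u s) ≤ C * ν (Ioc s s'))
    (hae : ∀ᵐ s ∂ν, s ∈ Ico a b → ∀ᶠ s' in 𝓝[>] s, u s' ≤ u s) : u b ≤ u a := by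
  set E := toMeasurable ν {s | ¬ (s ∈ Ico a b → ∀ᶠ s' in 𝓝[>] s, u s' ≤ u s)} with hE
  have hE0 : ν E = 0 := by rw [hE, measure_toMeasurable]; exact hae
  have hEm : MeasurableSet E := measurableSet_toMeasurable _ _
  suffices h : ENNReal.ofReal (u b - u a) ≤ 0 by
    have := ENNReal.ofReal_eq_zero.1 (le_antisymm h bot_le)
    linarith
  refine le_of_forall_pos_le_add fun ε hε => ?_
  obtain ⟨ψ, hψE, hψ, hψint⟩ := exists_le_lowerSemicontinuous_lintegral_ge ν
    (E.indicator fun _ => ∞) (measurable_const.indicator hEm) hε.ne'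
  rw [lintegral_indicator hEm, setLIntegral_measure_zero _ _ hE0] at hψint
  refine le_trans ?_ hψint
  suffices h : ENNReal.ofReal (u b - u a) ≤ ∫⁻ x in Ioc a b, ψ x ∂ν from
    h.trans (setLIntegral_le_lintegral _ _)
  refine Icc_continuous_induction (P := fun t => ENNReal.ofReal (u t - u a) ≤
    ∫⁻ x in Ioc a t, ψ x ∂ν) hab (by simp) ?_ ?_
  · intro t ht hs
    have hmem : Ico a t ∈ 𝓝[<] t := Ico_mem_nhdsLT ht.1
    have hcont : Tendsto (fun s => ENNReal.ofReal (u s - u a)) (𝓝[<] t)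
        (𝓝 (ENNReal.ofReal (u t - u a))) := by
      refine (ENNReal.continuous_ofReal.tendsto _).comp (Tendsto.sub_const ?_ _)
      refine (hu t ⟨ht.1.le, ht.2⟩).mono_left ?_
      exact nhdsWithin_le_of_mem (mem_of_superset hmem fun s hs => ⟨hs.1, hs.2.le.trans ht.2⟩)
    refine le_of_tendsto hcont (mem_of_superset hmem fun s h => (hs s h).trans ?_)
    exact lintegral_mono_set (Ioc_subset_Ioc_right h.2.le)
  · intro t ht hPt
    have key : ∀ᶠ s in 𝓝[>] t, ENNReal.ofReal (u s - u t) ≤ ∫⁻ x in Ioc t s, ψ x ∂ν := by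
      by_cases htE : t ∈ E
      · obtain ⟨C, hC⟩ := hloc t ht
        have hψt : (C : ℝ≥0∞) < ψ t := by
          refine lt_of_lt_of_le ?_ (hψE t)
          simp [htE]
        obtain ⟨l, hl, hlC⟩ := (mem_nhdsGE_iff_exists_Ico_subset).1
          (mem_nhdsWithin_of_mem_nhds (a := t) (s := {x | (C : ℝ≥0∞) < ψ x}) (hψ t C hψt))
        filter_upwards [hC, Ioo_mem_nhdsGT hl] with s hs hsl
        refine hs.trans ?_
        rw [← setLIntegral_const]
        exact setLIntegral_mono' measurableSet_Ioc fun x hx =>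
          (hlC ⟨hx.1.le, hx.2.trans_lt hsl.2⟩ : (C : ℝ≥0∞) < ψ x).le
      · have : t ∈ Ico a b → ∀ᶠ s' in 𝓝[>] t, u s' ≤ u t := by
          by_contra h
          exact htE (subset_toMeasurable _ _ h)
        filter_upwards [this ht] with s hs
        rw [ENNReal.ofReal_of_nonpos (by linarith)]
        exact bot_le
    filter_upwards [key, self_mem_nhdsWithin] with s hs hts
    calc ENNReal.ofReal (u s - u a) = ENNReal.ofReal ((u t - u a) + (u s - u t)) := by ring_nf
      _ ≤ ENNReal.ofReal (u t - u a) + ENNReal.ofReal (u s - u t) := ENNReal.ofReal_add_le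
      _ ≤ ∫⁻ x in Ioc a t, ψ x ∂ν + ∫⁻ x in Ioc t s, ψ x ∂ν := add_le_add hPt hs
      _ = ∫⁻ x in Ioc a s, ψ x ∂ν := by
        rw [← lintegral_union measurableSet_Ioc (Ioc_disjoint_Ioc_of_le le_rfl),
          Ioc_union_Ioc_eq_Ioc ht.1 (le_of_lt hts)]

/-- If a differentiable function has derivative less than `-δ` along an absolutely continuous
curve, then it decreases at rate at least `δ` along this curve. -/
theorem add_mul_le_of_fderiv_lt {E : Type*} [NormedAddCommGroup E] [NormedSpace ℝ E]
    [CompleteSpace E] {V : E → ℝ} (hV : Differentiable ℝ V) {y F : ℝ → E} {a b δ : ℝ}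
    (hab : a ≤ b) (hδ : 0 ≤ δ) (hF : IntervalIntegrable F volume a b)
    (hy : ∀ t ∈ Icc a b, y t = y a + ∫ s in a..t, F s)
    (hlt : ∀ s ∈ Ioo a b, fderiv ℝ V (y s) (F s) < -δ) :
    V (y b) + δ * (b - a) ≤ V (y a) := by
  have hFi : IntegrableOn F (Ioc a b) := (intervalIntegrable_iff_integrableOn_Ioc_of_le hab).1 hF
  have hyc : ContinuousOn y (Icc a b) := by
    refine ContinuousOn.congr (continuousOn_const.add ?_) hy
    have := intervalIntegral.continuousOn_primitive_interval (μ := volume) (f := F) (a := a)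
      (b := b) (by rw [uIcc_of_le hab]; exact (integrableOn_Icc_iff_integrableOn_Ioc (by simp)).2 hFi)
    rwa [uIcc_of_le hab] at this
  set ν := (volume.restrict (Ioc a b)).withDensity fun s => ‖F s‖ₑ + 1 with hν
  have : IsFiniteMeasure ν := by
    refine isFiniteMeasure_withDensity ?_
    rw [lintegral_add_right _ measurable_const]
    have h := hFi.2
    simp only [HasFiniteIntegral] at h
    simp [h.ne]
  have hνIoc : ∀ s ∈ Icc a b, ∀ s' ∈ Icc a b,
      ν (Ioc s s') = ∫⁻ r in Ioc s s', (‖F r‖ₑ + 1) := by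
    intro s hs s' hs'
    rw [hν, withDensity_apply _ measurableSet_Ioc, Measure.restrict_restrict measurableSet_Ioc,
      inter_eq_left.2 (Ioc_subset_Ioc hs.1 hs'.2)]
  have hsub : ∀ s ∈ Icc a b, ∀ s' ∈ Icc a b, y s' - y s = ∫ r in s..s', F r := by
    intro s hs s' hs'
    have hsF : ∀ t ∈ Icc a b, IntervalIntegrable F volume a t := fun t ht =>
      hF.mono_set (by rw [uIcc_of_le hab, uIcc_of_le ht.1]; exact Icc_subset_Icc_right ht.2)
    rw [hy s hs, hy s' hs', add_sub_add_left_eq_sub,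
      intervalIntegral.integral_interval_sub_left (hsF s' hs') (hsF s hs)]
  have hyν : ∀ s ∈ Icc a b, ∀ s' ∈ Icc a b, s ≤ s' →
      ENNReal.ofReal ‖y s' - y s‖ ≤ ν (Ioc s s') := by
    intro s hs s' hs' hss
    rw [hνIoc s hs s' hs', hsub s hs s' hs', ofReal_norm, intervalIntegral.integral_of_le hss]
    exact (enorm_integral_le_lintegral_enorm _).trans (lintegral_mono fun _ => le_self_add)
  have htν : ∀ s ∈ Icc a b, ∀ s' ∈ Icc a b, ENNReal.ofReal (s' - s) ≤ ν (Ioc s s') := by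
    intro s hs s' hs'
    rw [hνIoc s hs s' hs', ← Real.volume_Ioc, ← setLIntegral_one]
    exact lintegral_mono fun _ => le_add_self
  suffices h : V (y b) + δ * (b - a) ≤ V (y a) + δ * (a - a) by simpa using h
  refine le_of_ae_eventually_le (u := fun t => V (y t) + δ * (t - a)) hab ν ?_ ?_ ?_
  · exact (hV.continuous.comp_continuousOn hyc).add (by fun_prop)
  · intro s hs
    obtain ⟨C, hC⟩ := (hV (y s)).isBigO_sub.bound
    have hmem : Ioc s b ∈ 𝓝[>] s := Ioc_mem_nhdsGT hs.2
    have hytend : Tendsto y (𝓝[>] s) (𝓝 (y s)) := (hyc s ⟨hs.1, hs.2.le⟩).mono_left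
      (nhdsWithin_le_of_mem (mem_of_superset hmem fun r hr => ⟨hs.1.trans hr.1.le, hr.2⟩))
    refine ⟨C.toNNReal + δ.toNNReal, ?_⟩
    filter_upwards [hytend hC, hmem] with s' hs' hsm
    have hm : s' ∈ Icc a b := ⟨hs.1.trans hsm.1.le, hsm.2⟩
    have hm0 : s ∈ Icc a b := ⟨hs.1, hs.2.le⟩
    have h1 : V (y s') - V (y s) ≤ C.toNNReal * ‖y s' - y s‖ :=
      (le_abs_self _).trans (le_trans hs' (mul_le_mul_of_nonneg_right (Real.le_coe_toNNReal C)
        (norm_nonneg _)))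
    calc ENNReal.ofReal (V (y s') + δ * (s' - a) - (V (y s) + δ * (s - a)))
        ≤ ENNReal.ofReal (C.toNNReal * ‖y s' - y s‖ + δ * (s' - s)) :=
          ENNReal.ofReal_le_ofReal (by linarith)
      _ ≤ ENNReal.ofReal (C.toNNReal * ‖y s' - y s‖) + ENNReal.ofReal (δ * (s' - s)) :=
          ENNReal.ofReal_add_le
      _ = C.toNNReal * ENNReal.ofReal ‖y s' - y s‖ + δ.toNNReal * ENNReal.ofReal (s' - s) := by
          rw [ENNReal.ofReal_mul (NNReal.coe_nonneg _), ENNReal.ofReal_mul hδ,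
            ENNReal.ofReal_coe_nnreal]
          rfl
      _ ≤ C.toNNReal * ν (Ioc s s') + δ.toNNReal * ν (Ioc s s') := by
          gcongr
          · exact hyν s hm0 s' hm hsm.1.le
          · exact htν s hm0 s' hm
      _ = _ := by push_cast; rw [add_mul]
  · have hac : ν ≪ volume :=
      (withDensity_absolutelyContinuous _ _).trans Measure.restrict_le_self.absolutelyContinuous
    filter_upwards [hac.ae_le hF.ae_hasDerivAt_integral,
      hac.ae_le (compl_mem_ae_iff.2 (measure_singleton a))] with s hs hsa hsab
    have hd := hs (by rw [uIcc_of_le hab]; exact ⟨hsab.1, hsab.2.le⟩) a left_mem_uIcc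
    have hyd : HasDerivWithinAt y (F s) (Icc a b) s :=
      ((hd.const_add (y a)).hasDerivWithinAt).congr hy (hy s ⟨hsab.1, hsab.2.le⟩)
    have hud : HasDerivWithinAt (fun t => V (y t) + δ * (t - a))
        (fderiv ℝ V (y s) (F s) + δ * 1) (Icc a b) s :=
      ((hV (y s)).hasFDerivAt.comp_hasDerivWithinAt s hyd).add
        (((hasDerivWithinAt_id s _).sub_const a).const_mul δ)
    have hneg : fderiv ℝ V (y s) (F s) + δ * 1 < 0 := by 
      linarith [hlt s ⟨lt_of_le_of_ne hsab.1 (Ne.symm hsa), hsab.2⟩]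
    have hslope := hud.mono_of_mem_nhdsWithin (mem_of_superset
      (Ioc_mem_nhdsGT hsab.2) fun r hr => ⟨hsab.1.trans hr.1.le, hr.2⟩ : Icc a b ∈ 𝓝[>] s)
    filter_upwards [hslope.limsup_slope_le' (by simp) hneg, self_mem_nhdsWithin] with r hr hsr
    rw [slope_def_field, div_neg_iff] at hr
    have : 0 < r - s := sub_pos.2 hsr
    rcases hr with hr | hr <;> linarith

/-- A quantity that decreases along an absolutely continuous curve while it exceeds the level `ℓ`
cannot exceed `ℓ` if it does not do so initially. -/
theorem le_of_fderiv_lt_of_le {E : Type*} [NormedAddCommGroup E] [NormedSpace ℝ E]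
    [CompleteSpace E] {V : E → ℝ} (hV : Differentiable ℝ V) {y F : ℝ → E} {a b δ ℓ : ℝ}
    (hab : a ≤ b) (hδ : 0 ≤ δ) (hyc : ContinuousOn y (Icc a b))
    (hF : ∀ s ∈ Icc a b, IntervalIntegrable F volume s b)
    (hy : ∀ s ∈ Icc a b, ∀ t ∈ Icc s b, y t = y s + ∫ r in s..t, F r)
    (hlt : ∀ s ∈ Icc a b, ℓ ≤ V (y s) → fderiv ℝ V (y s) (F s) < -δ)
    (ha : V (y a) ≤ ℓ) : V (y b) ≤ ℓ := by
  have hcl : IsClosed (Icc a b ∩ (fun t => V (y t)) ⁻¹' Iic ℓ) :=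
    (hV.continuous.comp_continuousOn hyc).preimage_isClosed_of_isClosed isClosed_Icc isClosed_Iic
  obtain ⟨c, hc, hcmax⟩ := (isCompact_Icc.of_isClosed_subset hcl inter_subset_left).exists_isGreatest
    ⟨a, ⟨le_rfl, hab⟩, ha⟩
  have h := add_mul_le_of_fderiv_lt hV hc.1.2 hδ (hF c hc.1) (hy c hc.1) fun s hs => by
    have hs' : s ∈ Icc a b := ⟨hc.1.1.trans hs.1.le, hs.2.le⟩
    refine hlt s hs' (le_of_not_ge fun hle => ?_)
    exact absurd (hcmax ⟨hs', hle⟩) (not_le.2 hs.1)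
  have hc2 : V (y c) ≤ ℓ := hc.2
  nlinarith [mul_nonneg hδ (sub_nonneg.2 hc.1.2)]

theorem ClassKInf.le_iff_le {f : ℝ → ℝ} (hf : ClassKInf f) {r s : ℝ} (hr : 0 ≤ r) (hs : 0 ≤ s) :
    f r ≤ f s ↔ r ≤ s :=
  hf.1.2.1.le_iff_le hr hs

theorem ClassKInf.lt_iff_lt {f : ℝ → ℝ} (hf : ClassKInf f) {r s : ℝ} (hr : 0 ≤ r) (hs : 0 ≤ s) :
    f r < f s ↔ r < s :=
  hf.1.2.1.lt_iff_lt hr hs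

theorem ClassKInf.pos {f : ℝ → ℝ} (hf : ClassKInf f) {r : ℝ} (hr : 0 < r) : 0 < f r := by
  have := (hf.lt_iff_lt le_rfl hr.le).2 hr
  rwa [hf.1.2.2.2] at this

theorem ClassKInf.nonneg_of_leftInverse {f finv : ℝ → ℝ} (hf : ClassKInf f)
    (hinv : ∀ r, 0 ≤ r → finv (f r) = r) {v : ℝ} (hv : 0 ≤ v) : 0 ≤ finv v := by
  obtain ⟨R, hR, hR0⟩ := ((hf.2.eventually_ge_atTop v).and
    (Filter.eventually_ge_atTop 0)).exists
  have hsub := intermediate_value_Icc hR0 (hf.1.1.mono fun r hr => hr.1)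
  obtain ⟨r, hr, rfl⟩ := hsub ⟨hf.1.2.2.2.symm ▸ hv, hR⟩
  rw [hinv r hr.1]
  exact hr.1

theorem continuousOn_of_classKInf_or_zero {f : ℝ → ℝ} (hf : ClassKInf f ∨ f = 0) :
    ContinuousOn f (Ici 0) := by
  rcases hf with hf | rfl
  · exact hf.1.1
  · exact continuousOn_const

theorem monotoneOn_of_classKInf_or_zero {f : ℝ → ℝ} (hf : ClassKInf f ∨ f = 0) :
    MonotoneOn f (Ici 0) := by
  rcases hf with hf | rfl
  · exact hf.1.2.1.monotoneOn
  · exact monotoneOn_const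

theorem MAF.monotone {m : ℕ} {μ : (Fin m → ℝ) → ℝ} (hμ : MAF μ) : Monotone μ := by
  intro v z hvz
  have hc : Continuous fun ε : ℝ => μ fun k => z k + ε := hμ.1.comp (by fun_prop)
  have ht : Tendsto (fun ε : ℝ => μ fun k => z k + ε) (𝓝[>] 0) (𝓝 (μ z)) := by
    simpa using (hc.tendsto 0).mono_left nhdsWithin_le_nhds
  refine ge_of_tendsto ht ?_
  filter_upwards [self_mem_nhdsWithin] with ε hε
  refine (hμ.2.2.2.1 _ _ fun k => ?_).le
  linarith [hvz k, mem_Ioi.1 hε]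

/-- A continuous strict inequality `G i r < σ i r` persists when `r` is slightly increased on the
left-hand side and slightly decreased on the right-hand side. -/
theorem exists_lt_lt_of_continuousAt {ι : Type*} [Finite ι] {G σ : ι → ℝ → ℝ} {r : ℝ} (hr : 0 < r)
    (hG : ∀ i, ContinuousAt (G i) r) (hσ : ∀ i, ContinuousAt (σ i) r)
    (h : ∀ i, G i r < σ i r) :
    ∃ r₁ r₂, 0 < r₁ ∧ r₁ < r ∧ r < r₂ ∧ ∀ i, G i r₂ < σ i r₁ := by
  have hev : ∀ i, ∀ᶠ ε in 𝓝 (0 : ℝ), G i (r + ε) < σ i (r - ε) := by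
    intro i
    have h1 : ContinuousAt (fun ε : ℝ => G i (r + ε)) 0 :=
      ContinuousAt.comp (g := G i) (by simpa using hG i) (by fun_prop)
    have h2 : ContinuousAt (fun ε : ℝ => σ i (r - ε)) 0 :=
      ContinuousAt.comp (g := σ i) (by simpa using hσ i) (by fun_prop)
    exact h1.eventually_lt h2 (by simpa using h i)
  obtain ⟨ε, hε, hε'⟩ := (((eventually_all.2 hev).filter_mono nhdsWithin_le_nhds).and
    (Ioo_mem_nhdsGT hr)).exists
  exact ⟨r - ε, r + ε, by linarith [hε'.2], by linarith [hε'.1], by linarith [hε'.1], hε⟩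

/-- On the region where a proper positive definite `V` lies between two positive levels, a
positive definite function of the norm is bounded away from zero. -/
theorem PosDefFun.exists_pos_lt {E : Type*} [NormedAddCommGroup E] [ProperSpace E] {V : E → ℝ}
    (hV : Continuous V) {α₁ α₂ αpd : ℝ → ℝ} (hα₁ : ClassKInf α₁) (hα₂ : ClassKInf α₂)
    (hVbd : ∀ v, α₁ ‖v‖ ≤ V v ∧ V v ≤ α₂ ‖v‖) (hαpd : PosDefFun αpd) {ℓ M : ℝ} (hℓ : 0 < ℓ) :
    ∃ δ > 0, ∀ v, ℓ ≤ V v → V v ≤ M → δ < αpd ‖v‖ := by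
  have hcl : IsClosed {v | ℓ ≤ V v ∧ V v ≤ M} :=
    (isClosed_le continuous_const hV).inter (isClosed_le hV continuous_const)
  obtain ⟨R, hR, hR0⟩ := ((hα₁.2.eventually_ge_atTop M).and (eventually_ge_atTop 0)).exists
  have hcpt : IsCompact {v | ℓ ≤ V v ∧ V v ≤ M} := by
    refine (isCompact_closedBall (0 : E) R).of_isClosed_subset hcl fun v hv => ?_
    rw [mem_closedBall_zero_iff, ← hα₁.le_iff_le (norm_nonneg _) hR0]
    exact (hVbd v).1.trans (hv.2.trans hR)
  have hc : Continuous fun v : E => αpd ‖v‖ :=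
    hαpd.1.comp_continuous continuous_norm norm_nonneg
  obtain ⟨δ, hδ, hδv⟩ := hcpt.exists_forall_le' hc.continuousOn (a := 0) fun v hv => by
    refine lt_of_le_of_ne (hαpd.2.1 _ (norm_nonneg v)) fun h => ?_
    have h0 := (hαpd.2.2 _ (norm_nonneg v)).1 h.symm
    have := (hVbd v).2
    rw [h0, hα₂.1.2.2.2] at this
    linarith [hv.1]
  exact ⟨δ / 2, half_pos hδ, fun v h1 h2 => by linarith [hδv v ⟨h1, h2⟩]⟩

/-- **Theorem 2 of the paper (event-triggered stabilization).** Under Assumptions 1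
and 2, let `0 = t_0 < t_1 < …` be sampling times tending to infinity, let `x̂` be
constant on each interval between consecutive sampling times, and let `x` be a
(locally absolutely continuous) solution of `ẋ_i = f_i(x, g_i(x̂))`, expressed through
the integral equation. If `V_i(x_i(t)) ≥ χ_i(‖x̂_i(t) − x_i(t)‖)` for all `t ≥ 0` and
all `i`, then `t ↦ V(x(t)) = max_k σ_k⁻¹(V_k(x_k(t)))` is nonincreasing on `[0,∞)`
and `x(t) → 0` as `t → ∞`. -/
theorem statement1
    (N : ℕ) (hN : 0 < N)
    (n m : Fin N → ℕ)
    (f : ∀ i : Fin N, (∀ j, EuclideanSpace ℝ (Fin (n j))) →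
      EuclideanSpace ℝ (Fin (m i)) → EuclideanSpace ℝ (Fin (n i)))
    (g : ∀ i : Fin N, (∀ j, EuclideanSpace ℝ (Fin (n j))) → EuclideanSpace ℝ (Fin (m i)))
    (V : ∀ i : Fin N, EuclideanSpace ℝ (Fin (n i)) → ℝ)
    (α₁ α₂ : Fin N → ℝ → ℝ)
    (μ : Fin N → (Fin (N + N) → ℝ) → ℝ)
    (γ η φ φinv : Fin N → Fin N → ℝ → ℝ)
    (αpd : Fin N → ℝ → ℝ)
    (σ σinv : Fin N → ℝ → ℝ)
    (ηhat χ : Fin N → ℝ → ℝ)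
    -- Assumption 1
    (hVdiff : ∀ i, Differentiable ℝ (V i))
    (hα₁ : ∀ i, ClassKInf (α₁ i)) (hα₂ : ∀ i, ClassKInf (α₂ i))
    (hVbd : ∀ i xi, α₁ i ‖xi‖ ≤ V i xi ∧ V i xi ≤ α₂ i ‖xi‖)
    (hμ : ∀ i, MAF (μ i))
    (hγ : ∀ i j, ClassKInf (γ i j) ∨ γ i j = 0)
    (hγdiag : ∀ i, γ i i = 0)
    (hη : ∀ i j, ClassKInf (η i j) ∨ η i j = 0)
    (hαpd : ∀ i, PosDefFun (αpd i))
    (hA1 : ∀ i (x e : ∀ j, EuclideanSpace ℝ (Fin (n j))),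
      μ i (Fin.append (fun j => γ i j (V j (x j))) (fun j => η i j ‖e j‖)) ≤ V i (x i) →
      fderiv ℝ (V i) (x i) (f i x (g i (x + e))) ≤ -(αpd i ‖x i‖))
    -- Assumption 2
    (hσ : ∀ i, ClassKInf (σ i))
    (hσinv : ∀ i r, 0 ≤ r → σinv i (σ i r) = r ∧ σ i (σinv i r) = r)
    (hφ : ∀ i j, (η i j ≠ 0 → ClassKInf (φ i j)) ∧ (η i j = 0 → φ i j = 0))
    (hφinv : ∀ i j, η i j ≠ 0 → ∀ r, 0 ≤ r → φinv i j (φ i j r) = r ∧ φ i j (φinv i j r) = r)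
    (hA2 : ∀ i, ∀ r > (0 : ℝ),
      μ i (Fin.append (fun j => γ i j (σ j r)) (fun j => φ i j r)) < σ i r)
    -- definitions of `η̂_j` and `χ_j = σ_j ∘ η̂_j`
    (hηhat : ∀ j r, ηhat j r = ⨆ i ∈ {i : Fin N | η i j ≠ 0}, φinv i j (η i j r))
    (hχ : ∀ j r, χ j r = σ j (ηhat j r))
    -- the sampling times: strictly increasing, starting at 0, tending to infinity
    (t : ℕ → ℝ) (ht0 : t 0 = 0) (htmono : StrictMono t)
    (htlim : Filter.Tendsto t Filter.atTop Filter.atTop)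
    -- the information available at the controllers, constant between sampling times
    (xhat : ℝ → ∀ j, EuclideanSpace ℝ (Fin (n j)))
    (hxhat : ∀ k : ℕ, ∀ s₁ ∈ Set.Ioo (t k) (t (k + 1)), ∀ s₂ ∈ Set.Ioo (t k) (t (k + 1)),
      xhat s₁ = xhat s₂)
    -- the solution: locally absolutely continuous with `ẋ_i = f_i(x, g_i(x̂))` a.e.,
    -- expressed via the integral equation
    (x : ℝ → ∀ j, EuclideanSpace ℝ (Fin (n j)))
    (hxint : ∀ i, ∀ T : ℝ, 0 ≤ T →
      IntervalIntegrable (fun s => f i (x s) (g i (xhat s))) MeasureTheory.volume 0 T)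
    (hxsol : ∀ i, ∀ T : ℝ, 0 ≤ T →
      x T i = x 0 i + ∫ s in (0 : ℝ)..T, f i (x s) (g i (xhat s)))
    -- the event-triggering guarantee
    (htrig : ∀ T : ℝ, 0 ≤ T → ∀ i, χ i ‖xhat T i - x T i‖ ≤ V i (x T i)) :
    AntitoneOn (fun T => ⨆ k, σinv k (V k (x T k))) (Set.Ici 0) ∧
      Filter.Tendsto x Filter.atTop (nhds 0) := by
  have : Nonempty (Fin N) := ⟨⟨0, hN⟩⟩
  set G : Fin N → ℝ → ℝ := fun i r =>
    μ i (Fin.append (fun j => γ i j (σ j r)) (fun j => φ i j r)) with hG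
  have hφ' : ∀ i j, ClassKInf (φ i j) ∨ φ i j = 0 := fun i j => by
    by_cases h : η i j = 0
    · exact Or.inr ((hφ i j).2 h)
    · exact Or.inl ((hφ i j).1 h)
  have hV0 : ∀ k v, 0 ≤ V k v := fun k v =>
    ((hα₁ k).1.2.2.1 _ (norm_nonneg _)).trans (hVbd k v).1
  have hσinv0 : ∀ k v, 0 ≤ v → 0 ≤ σinv k v := fun k v =>
    (hσ k).nonneg_of_leftInverse fun r hr => (hσinv k r hr).1
  have hσle : ∀ k v r, 0 ≤ v → 0 ≤ r → (σinv k v ≤ r ↔ v ≤ σ k r) := fun k v r hv hr => by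
    rw [← (hσ k).le_iff_le (hσinv0 k v hv) hr, (hσinv k v hv).2]
  have hφinv0 : ∀ i j, η i j ≠ 0 → ∀ r, 0 ≤ r → 0 ≤ φinv i j r := fun i j h r =>
    ((hφ i j).1 h).nonneg_of_leftInverse fun r hr => (hφinv i j h r hr).1
  have hη0 : ∀ i j r, 0 ≤ r → 0 ≤ η i j r := fun i j r hr => by
    rcases hη i j with h | h
    · exact h.1.2.2.1 r hr
    · simp [h]
  have hηhat_ge : ∀ i j r, η i j ≠ 0 → φinv i j (η i j r) ≤ ηhat j r := by
    intro i j r h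
    rw [hηhat]
    refine le_trans ?_ (le_ciSup (finite_range _).bddAbove i)
    have : i ∈ {i : Fin N | η i j ≠ 0} := h
    simp [h]
  have hηhat0 : ∀ j r, 0 ≤ r → 0 ≤ ηhat j r := by
    intro j r hr
    rw [hηhat]
    refine Real.iSup_nonneg fun i => Real.iSup_nonneg fun h => ?_
    exact hφinv0 i j h _ (hη0 i j r hr)
  -- the aggregated gains are dominated by the small-gain bound on sublevel sets
  have hgain : ∀ s, 0 ≤ s → ∀ R, 0 ≤ R → (∀ j, V j (x s j) ≤ σ j R) → ∀ i,
      μ i (Fin.append (fun j => γ i j (V j (x s j)))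
        (fun j => η i j ‖(xhat s - x s) j‖)) ≤ G i R := by
    intro s hs R hR hle i
    refine (hμ i).monotone ?_
    intro k
    refine Fin.addCases (fun j => ?_) (fun j => ?_) k
    · simp only [Fin.append_left]
      exact monotoneOn_of_classKInf_or_zero (hγ i j) (hV0 j _) ((hσ j).1.2.2.1 R hR) (hle j)
    · simp only [Fin.append_right]
      by_cases h : η i j = 0
      · simp [h, (hφ i j).2 h]
      · have h1 := (htrig s hs j).trans (hle j)
        rw [hχ, (hσ j).le_iff_le (hηhat0 j _ (norm_nonneg _)) hR] at h1
        have h2 := (hηhat_ge i j _ h).trans h1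
        have hn := hη0 i j _ (norm_nonneg (xhat s j - x s j))
        have hφk := (hφ i j).1 h
        rw [← hφk.le_iff_le (hφinv0 i j h _ hn) hR, (hφinv i j h _ hn).2] at h2
        exact h2
  have hgap : ∀ r, 0 < r → ∃ r₁ r₂, 0 < r₁ ∧ r₁ < r ∧ r < r₂ ∧ ∀ i, G i r₂ < σ i r₁ := by
    intro r hr
    refine exists_lt_lt_of_continuousAt hr (fun i => ?_)
      (fun i => (hσ i).1.1.continuousAt (Ici_mem_nhds hr)) fun i => hA2 i r hr
    refine ContinuousOn.continuousAt (s := Ici 0) ?_ (Ici_mem_nhds hr)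
    refine (hμ i).1.comp_continuousOn (continuousOn_pi.2 fun k => ?_)
    refine Fin.addCases (fun j => ?_) (fun j => ?_) k
    · simp only [Fin.append_left]
      exact (continuousOn_of_classKInf_or_zero (hγ i j)).comp (hσ j).1.1 (hσ j).1.2.2.1
    · simp only [Fin.append_right]
      exact continuousOn_of_classKInf_or_zero (hφ' i j)
  have hdecay : ∀ r₁ r₂, 0 < r₁ → r₁ < r₂ → (∀ i, G i r₂ < σ i r₁) → ∀ i, ∃ δ > 0,
      ∀ s, 0 ≤ s → (∀ j, V j (x s j) ≤ σ j r₂) → σ i r₁ ≤ V i (x s i) →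
        fderiv ℝ (V i) (x s i) (f i (x s) (g i (xhat s))) < -δ := by
    intro r₁ r₂ hr₁ hr h i
    obtain ⟨δ, hδ, hδv⟩ := (hαpd i).exists_pos_lt (hVdiff i).continuous (hα₁ i) (hα₂ i) (hVbd i)
      (ℓ := σ i r₁) (M := σ i r₂) ((hσ i).pos hr₁)
    refine ⟨δ, hδ, fun s hs hle hge => ?_⟩
    have h1 := hA1 i (x s) (xhat s - x s)
      (((hgain s hs r₂ (hr₁.trans hr).le hle i).trans (h i).le).trans hge)
    rw [add_sub_cancel] at h1
    linarith [hδv _ hge (hle i)]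
  have hint : ∀ i a b, 0 ≤ a → 0 ≤ b →
      IntervalIntegrable (fun s => f i (x s) (g i (xhat s))) volume a b := fun i a b ha hb =>
    (hxint i a ha).symm.trans (hxint i b hb)
  have hsol : ∀ i a b, 0 ≤ a → 0 ≤ b →
      x b i = x a i + ∫ s in a..b, f i (x s) (g i (xhat s)) := by
    intro i a b ha hb
    rw [hxsol i a ha, hxsol i b hb, add_assoc, intervalIntegral.integral_add_adjacent_intervals
      (hxint i a ha) (hint i a b ha hb)]
  have hcont : ∀ i a b, 0 ≤ a → a ≤ b → ContinuousOn (fun s => x s i) (Icc a b) := by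
    intro i a b ha hab
    have h := intervalIntegral.continuousOn_primitive_interval' (hint i a b ha (ha.trans hab))
      left_mem_uIcc
    rw [uIcc_of_le hab] at h
    exact (continuousOn_const.add h).congr fun s hs => hsol i a s ha (ha.trans hs.1)
  have hbarrier : ∀ i a b δ ℓ, 0 ≤ a → a ≤ b → 0 ≤ δ →
      (∀ s ∈ Icc a b, ℓ ≤ V i (x s i) →
        fderiv ℝ (V i) (x s i) (f i (x s) (g i (xhat s))) < -δ) →
      V i (x a i) ≤ ℓ → V i (x b i) ≤ ℓ := by
    intro i a b δ ℓ ha hab hδ hlt hle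
    exact le_of_fderiv_lt_of_le (y := fun s => x s i) (hVdiff i) hab hδ (hcont i a b ha hab)
      (fun s hs => hint i s b (ha.trans hs.1) (ha.trans hab))
      (fun s hs t ht => hsol i s t (ha.trans hs.1) ((ha.trans hs.1).trans ht.1)) hlt hle
  have hinvariant : ∀ r, 0 < r → ∀ a b, 0 ≤ a → a ≤ b → (∀ k, V k (x a k) ≤ σ k r) →
      ∀ k, V k (x b k) ≤ σ k r := by
    intro r hr a b ha hab hle
    obtain ⟨r₁, r₂, hr₁, h₁, h₂, hlt⟩ := hgap r hr
    choose δ hδ hd using hdecay r₁ r₂ hr₁ (h₁.trans h₂) hlt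
    have hVc : ∀ k, ContinuousOn (fun s => V k (x s k)) (Icc a b) := fun k =>
      (hVdiff k).continuous.comp_continuousOn (hcont k a b ha hab)
    refine Icc_continuous_induction (P := fun t => ∀ k, V k (x t k) ≤ σ k r) hab hle ?_ ?_
    · intro t ht hs k
      have hmem : Ico a t ∈ 𝓝[<] t := Ico_mem_nhdsLT ht.1
      have hten : Tendsto (fun s => V k (x s k)) (𝓝[<] t) (𝓝 (V k (x t k))) :=
        (hVc k t ⟨ht.1.le, ht.2⟩).mono_left (nhdsWithin_le_of_mem
          (mem_of_superset hmem fun s hs => ⟨hs.1, hs.2.le.trans ht.2⟩))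
      exact le_of_tendsto hten (mem_of_superset hmem fun s h => hs s h k)
    · intro t ht hPt
      have hev : ∀ᶠ s in 𝓝[≥] t, ∀ k, V k (x s k) < σ k r₂ := by
        refine eventually_all.2 fun k => ?_
        have hten : Tendsto (fun s => V k (x s k)) (𝓝[≥] t) (𝓝 (V k (x t k))) :=
          (hVc k t ⟨ht.1, ht.2.le⟩).mono_left (nhdsWithin_le_of_mem
            (mem_of_superset (Icc_mem_nhdsGE ht.2) fun s hs => ⟨ht.1.trans hs.1, hs.2⟩))
        exact hten.eventually_lt_const
          ((hPt k).trans_lt (((hσ k).lt_iff_lt hr.le (hr.trans h₂).le).2 h₂))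
      obtain ⟨c, hc, hcV⟩ := mem_nhdsGE_iff_exists_Ico_subset.1 hev
      filter_upwards [Ioo_mem_nhdsGT hc] with s hs k
      have ht0 : 0 ≤ t := ha.trans ht.1
      refine hbarrier k t s (δ k) _ ht0 hs.1.le (hδ k).le (fun q hq hge => ?_) (hPt k)
      refine hd k q (ht0.trans hq.1) (fun j => (hcV ⟨hq.1, hq.2.trans_lt hs.2⟩ j).le)
        (le_trans ?_ hge)
      exact ((hσ k).le_iff_le hr₁.le hr.le).2 h₁.le
  have hsup_le : ∀ s r, 0 ≤ r →
      ((⨆ k, σinv k (V k (x s k))) ≤ r ↔ ∀ k, V k (x s k) ≤ σ k r) := by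
    intro s r hr
    rw [ciSup_le_iff (finite_range _).bddAbove]
    exact forall_congr' fun k => hσle k _ r (hV0 k _) hr
  have hsup0 : ∀ s, 0 ≤ ⨆ k, σinv k (V k (x s k)) := fun s =>
    Real.iSup_nonneg fun k => hσinv0 k _ (hV0 k _)
  have hreach : ∀ r, 0 < r → ∃ T, 0 ≤ T ∧ ∀ k, V k (x T k) ≤ σ k r := by
    set A := {r | 0 ≤ r ∧ ∃ T, 0 ≤ T ∧ ∀ k, V k (x T k) ≤ σ k r} with hA
    have hAne : A.Nonempty :=
      ⟨_, hsup0 0, 0, le_rfl, (hsup_le 0 _ (hsup0 0)).1 le_rfl⟩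
    have hAbdd : BddBelow A := ⟨0, fun r hr => hr.1⟩
    have hinf : sInf A ≤ 0 := by
      by_contra! hpos
      obtain ⟨r₁, r₂, hr₁, h₁, h₂, hlt⟩ := hgap _ hpos
      choose δ hδ hd using hdecay r₁ r₂ hr₁ (h₁.trans h₂) hlt
      obtain ⟨r, ⟨hr0, T, hT, hle⟩, hr⟩ := exists_lt_of_csInf_lt hAne h₂
      have hle₂ : ∀ s, T ≤ s → ∀ k, V k (x s k) ≤ σ k r₂ := fun s hs =>
        hinvariant r₂ (hpos.trans h₂) T s hT hs fun k =>
          (hle k).trans (((hσ k).le_iff_le hr0 (hpos.trans h₂).le).2 hr.le)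
      have hk : ∀ k, ∀ᶠ s in atTop, V k (x s k) ≤ σ k r₁ := by
        intro k
        obtain ⟨b, hb, hbk⟩ : ∃ b, T ≤ b ∧ V k (x b k) ≤ σ k r₁ := by
          by_contra! hgt
          set b := T + (V k (x T k) - σ k r₁) / δ k with hbdef
          have hTb : T ≤ b := by
            have := div_nonneg (sub_nonneg.2 (hgt T le_rfl).le) (hδ k).le
            linarith
          have h := add_mul_le_of_fderiv_lt (y := fun s => x s k) (hVdiff k) hTb (hδ k).le
            (hint k T b hT (hT.trans hTb)) (fun s hs => hsol k T s hT (hT.trans hs.1))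
            fun s hs => hd k s (hT.trans hs.1.le) (hle₂ s hs.1.le) (hgt s hs.1.le).le
          have hmul : δ k * (b - T) = V k (x T k) - σ k r₁ := by
            rw [hbdef, add_sub_cancel_left, mul_div_cancel₀ _ (hδ k).ne']
          linarith [hgt b hTb]
        filter_upwards [eventually_ge_atTop b] with s hs
        exact hbarrier k b s (δ k) _ (hT.trans hb) hs (hδ k).le (fun q hq hge =>
          hd k q ((hT.trans hb).trans hq.1) (hle₂ q (hb.trans hq.1)) hge) hbk
      obtain ⟨s, hs, hs0⟩ := ((eventually_all.2 hk).and (eventually_ge_atTop 0)).exists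
      exact absurd (csInf_le hAbdd ⟨hr₁.le, s, hs0, hs⟩) (not_le.2 h₁)
    intro r hr
    obtain ⟨r', ⟨hr'0, T, hT, hle⟩, hr'⟩ := exists_lt_of_csInf_lt hAne (hinf.trans_lt hr)
    exact ⟨T, hT, fun k => (hle k).trans (((hσ k).le_iff_le hr'0 hr.le).2 hr'.le)⟩
  constructor
  · intro a ha b _ hab
    refine le_of_forall_gt_imp_ge_of_dense fun r hr => ?_
    have hr0 : 0 < r := (hsup0 a).trans_lt hr
    exact (hsup_le b r hr0.le).2
      (hinvariant r hr0 a b ha hab ((hsup_le a r hr0.le).1 hr.le))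
  · rw [tendsto_pi_nhds]
    intro i
    rw [Pi.zero_apply, Metric.tendsto_nhds]
    intro ε hε
    have hα := (hα₁ i).pos hε
    have hσ0 : ∀ᶠ r in 𝓝[>] (0 : ℝ), σ i r < α₁ i ε := by
      have h : Tendsto (σ i) (𝓝[>] 0) (𝓝 (σ i 0)) :=
        ((hσ i).1.1 0 self_mem_Ici).mono_left (nhdsWithin_mono _ Ioi_subset_Ici_self)
      rw [(hσ i).1.2.2.2] at h
      exact h.eventually_lt_const hα
    obtain ⟨r, hr, hr0⟩ := (hσ0.and self_mem_nhdsWithin).exists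
    obtain ⟨T, hT, hle⟩ := hreach r hr0
    filter_upwards [eventually_ge_atTop T] with s hs
    rw [dist_zero_right, ← (hα₁ i).lt_iff_lt (norm_nonneg _) hε.le]
    exact ((hVbd i _).1.trans (hinvariant r hr0 T s hT hs hle i)).trans_lt hr
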